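/- arXiv:2003.12825 — 2 statements merged into one kernel-verified Lean document; each statement's English description precedes it below -/
import Mathlib

section
/- Work on [0,1] with a kernel K satisfying Assumption (K), let σ : ℝ → (0,∞) be continuously differentiable, ρ ∈ (−1,1), ρ̄ := √(1−ρ²), x ∈ ℝ, and define for f ∈ H₀¹[0,1]: Ẽ(f) := ∫₀¹ ḟ(s)² ds, F̃(f) := ∫₀¹ σ(𝒦(f²)(s))² ds, G̃(f) := ∫₀¹ σ(𝒦(f²)(s)) ḟ(s) ds, and 𝓘_x(f) := (x − ρ G̃(f))² / (2 ρ̄² F̃(f)) + ½ Ẽ(f). Suppose f ∈ H₀¹[0,1] minimizes 𝓘_x over H₀¹[0,1]. Then for every t ∈ [0,1], with id_{≤t}(s) := min(s,t) and 𝒦(f·id_{≤t})(u) := ∫₀^u K(u,s) f(s) min(s,t) ds, the minimizer satisfies f(t) = ρ (x − ρ G̃(f)) [ ∫₀^t σ(𝒦(f²)(s)) ds + 2 ∫₀¹ σ′(𝒦(f²)(s)) ḟ(s) 𝒦(f·id_{≤t})(s) ds ] / (ρ̄² F̃(f)) + (x − ρ G̃(f))² / (ρ̄² F̃(f)²) ·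 ∫₀¹ (σ²)′(𝒦(f²)(s)) 𝒦(f·id_{≤t})(s) ds. -/
open MeasureTheory Set

/-- `𝒦(fg)(t) = ∫₀^t K(t,s) f(s) g(s) ds` (Volterra integral transform on `[0,1]`). -/
noncomputable def Kop (K : ℝ → ℝ → ℝ) (f g : ℝ → ℝ) (t : ℝ) : ℝ :=
  ∫ s in Icc (0:ℝ) t, K t s * (f s * g s)

/-- `Ẽ(f) = ∫₀¹ ḟ²`. -/
noncomputable def Etil (df : ℝ → ℝ) : ℝ := ∫ s in Icc (0:ℝ) 1, (df s)^2

/-- `F̃(f) = ∫₀¹ σ(𝒦(f²)(s))² ds`. -/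
noncomputable def Ftil (K : ℝ → ℝ → ℝ) (σ f : ℝ → ℝ) : ℝ :=
  ∫ s in Icc (0:ℝ) 1, (σ (Kop K f f s))^2

/-- `G̃(f) = ∫₀¹ σ(𝒦(f²)(s)) ḟ(s) ds`. -/
noncomputable def Gtil (K : ℝ → ℝ → ℝ) (σ f df : ℝ → ℝ) : ℝ :=
  ∫ s in Icc (0:ℝ) 1, σ (Kop K f f s) * df s

/-- `𝓘ₓ(f) = (x − ρG̃(f))²/(2ρ̄²F̃(f)) + ½Ẽ(f)`. -/
noncomputable def Ifun (K : ℝ → ℝ → ℝ) (σ : ℝ → ℝ) (ρ x : ℝ) (f df : ℝ → ℝ) : ℝ :=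
  (x - ρ * Gtil K σ f df)^2 / (2 * (1 - ρ^2) * Ftil K σ f) + (1/2) * Etil df


lemma aux_intK (K : ℝ → ℝ → ℝ) (hKmeas : Measurable (Function.uncurry K))
    (hKint : ∀ t ∈ Icc (0:ℝ) 1, IntegrableOn (fun s => (K t s)^2) (Icc (0:ℝ) 1))
    (w : ℝ → ℝ) (M : ℝ) (hw : AEStronglyMeasurable w (volume.restrict (Icc (0:ℝ) 1)))
    (hM : ∀ u ∈ Icc (0:ℝ) 1, |w u| ≤ M) (s : ℝ) (hs : s ∈ Icc (0:ℝ) 1) :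
    IntegrableOn (fun u => K s u * w u) (Icc (0:ℝ) 1) := by
  have hKs : Measurable (K s) := hKmeas.comp (measurable_const.prodMk measurable_id)
  have h1 : IntegrableOn (fun u => (1 + (K s u)^2) * M) (Icc (0:ℝ) 1) :=
    Integrable.mul_const (Integrable.add (integrable_const _) (hKint s hs)) M
  refine Integrable.mono' h1 (hKs.aestronglyMeasurable.mul hw) ?_
  filter_upwards [ae_restrict_mem measurableSet_Icc] with u hu
  rw [Real.norm_eq_abs, abs_mul]
  have h2 := hM u hu
  have h3 : |K s u| ≤ 1 + (K s u)^2 := by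
    rw [← sq_abs]; nlinarith [sq_nonneg (|K s u| - 1), abs_nonneg (K s u)]
  exact mul_le_mul h3 h2 (abs_nonneg _) (by positivity)

lemma aux_boundK (K : ℝ → ℝ → ℝ) (hKmeas : Measurable (Function.uncurry K))
    (hKint : ∀ t ∈ Icc (0:ℝ) 1, IntegrableOn (fun s => (K t s)^2) (Icc (0:ℝ) 1))
    (CK : ℝ) (hKbdd : ∀ t ∈ Icc (0:ℝ) 1, (∫ s in Icc (0:ℝ) 1, (K t s)^2) ≤ CK)
    (w : ℝ → ℝ) (M : ℝ) 
    (hM : ∀ u ∈ Icc (0:ℝ) 1, |w u| ≤ M) (s : ℝ) (hs : s ∈ Icc (0:ℝ) 1) :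
    |∫ u in Icc (0:ℝ) 1, K s u * w u| ≤ (1 + CK) * M := by
  have hM0 : 0 ≤ M := (abs_nonneg _).trans (hM s hs)
  have h1 : IntegrableOn (fun u => (1 + (K s u)^2) * M) (Icc (0:ℝ) 1) :=
    Integrable.mul_const (Integrable.add (integrable_const _) (hKint s hs)) M
  have h4 : ‖∫ u in Icc (0:ℝ) 1, K s u * w u‖ ≤ ∫ u in Icc (0:ℝ) 1, (1 + (K s u)^2) * M := by
    refine norm_integral_le_of_norm_le h1 ?_
    filter_upwards [ae_restrict_mem measurableSet_Icc] with u hu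
    rw [Real.norm_eq_abs, abs_mul]
    have h2 := hM u hu
    have h3 : |K s u| ≤ 1 + (K s u)^2 := by
      rw [← sq_abs]; nlinarith [sq_nonneg (|K s u| - 1), abs_nonneg (K s u)]
    exact mul_le_mul h3 h2 (abs_nonneg _) (by positivity)
  rw [integral_mul_const, integral_add (integrable_const _) (hKint s hs)] at h4
  have h5 := hKbdd s hs
  simp only [Real.norm_eq_abs, integral_const, smul_eq_mul, mul_one] at h4
  have h6 : (volume.restrict (Icc (0:ℝ) 1)).real univ = 1 := by simp
  rw [h6] at h4
  exact h4.trans (mul_le_mul_of_nonneg_right (by linarith) hM0)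

lemma aux_measK (K : ℝ → ℝ → ℝ) (hKmeas : Measurable (Function.uncurry K))
    (w : ℝ → ℝ) (hw : AEStronglyMeasurable w (volume.restrict (Icc (0:ℝ) 1))) :
    StronglyMeasurable (fun s => ∫ u in Icc (0:ℝ) 1, K s u * w u) := by
  have h1 : (fun s => ∫ u in Icc (0:ℝ) 1, K s u * w u) =
      fun s => ∫ u in Icc (0:ℝ) 1, K s u * hw.mk w u := by
    funext s
    refine integral_congr_ae ?_
    filter_upwards [hw.ae_eq_mk] with u hu
    rw [hu]
  rw [h1]
  have h2 : StronglyMeasurable (Function.uncurry fun s u => K s u * hw.mk w u) :=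
    hKmeas.stronglyMeasurable.mul (hw.stronglyMeasurable_mk.comp_measurable measurable_snd)
  exact h2.integral_prod_right

lemma aux_KopEq (K : ℝ → ℝ → ℝ)
    (hKvolterra : ∀ t s : ℝ, 0 ≤ t → t < s → s ≤ 1 → K t s = 0)
    (p q : ℝ → ℝ) (s : ℝ) (hs : s ∈ Icc (0:ℝ) 1) :
    Kop K p q s = ∫ u in Icc (0:ℝ) 1, K s u * (p u * q u) := by
  unfold Kop
  refine (setIntegral_eq_of_subset_of_forall_sdiff_eq_zero measurableSet_Icc
    (Icc_subset_Icc_right hs.2) ?_)  |>.symm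
  rintro u ⟨hu, hu'⟩
  have : s < u := by
    by_contra h
    exact hu' ⟨hu.1, not_lt.mp h⟩
  rw [hKvolterra s u hs.1 this hu.2, zero_mul]

lemma aux_deriv (μ : Measure ℝ) (φ : ℝ → ℝ) (hφ : ContDiff ℝ 1 φ)
    (a b c p q : ℝ → ℝ) (B : ℝ)
    (ha : AEStronglyMeasurable a μ) (hb : AEStronglyMeasurable b μ)
    (hc : AEStronglyMeasurable c μ)
    (haB : ∀ᵐ s ∂μ, |a s| ≤ B) (hbB : ∀ᵐ s ∂μ, |b s| ≤ B) (hcB : ∀ᵐ s ∂μ, |c s| ≤ B)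
    (hp : Integrable p μ) (hq : Integrable q μ) :
    HasDerivAt (fun ε : ℝ => ∫ s, φ (a s + 2 * ε * b s + ε^2 * c s) * (p s + ε * q s) ∂μ)
      (∫ s, (deriv φ (a s) * (2 * b s) * p s + φ (a s) * q s) ∂μ) 0 := by
  have hφ' : Continuous (deriv φ) := hφ.continuous_deriv le_rfl
  obtain ⟨S1, hS1⟩ := (isCompact_Icc (a := -(4*B)) (b := 4*B)).exists_bound_of_continuousOn
    hφ.continuous.continuousOn
  obtain ⟨S2, hS2⟩ := (isCompact_Icc (a := -(4*B)) (b := 4*B)).exists_bound_of_continuousOn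
    hφ'.continuousOn
  simp only [Real.norm_eq_abs] at hS1 hS2
  have harg : ∀ ε s, |ε| ≤ 1 → |a s| ≤ B → |b s| ≤ B → |c s| ≤ B →
      a s + 2 * ε * b s + ε^2 * c s ∈ Icc (-(4*B)) (4*B) := by
    intro ε s hε h1 h2 h3
    rw [mem_Icc, ← abs_le]
    have e1 : |2 * ε * b s| ≤ 2 * B := by
      rw [abs_mul, abs_mul, abs_two]
      nlinarith [abs_nonneg ε, abs_nonneg (b s)]
    have e2 : |ε^2 * c s| ≤ B := by
      rw [abs_mul, abs_pow]
      have : |ε|^2 ≤ 1 := pow_le_one₀ (abs_nonneg _) hε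
      nlinarith [abs_nonneg (c s)]
    have := abs_add_three (a s) (2 * ε * b s) (ε^2 * c s)
    linarith
  have hmeasArg : ∀ ε : ℝ, AEStronglyMeasurable (fun s => a s + 2 * ε * b s + ε^2 * c s) μ :=
    fun ε => (ha.add (hb.const_mul _)).add (hc.const_mul _)
  have hmeas : ∀ ε : ℝ, AEStronglyMeasurable
      (fun s => φ (a s + 2 * ε * b s + ε^2 * c s) * (p s + ε * q s)) μ := fun ε =>
    (hφ.continuous.comp_aestronglyMeasurable (hmeasArg ε)).mul
      (hp.aestronglyMeasurable.add (hq.aestronglyMeasurable.const_mul _))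
  have hbi : Integrable (fun s => S2 * (4 * B) * (|p s| + |q s|) + S1 * |q s|) μ :=
    ((hp.abs.add hq.abs).const_mul _).add (hq.abs.const_mul _)
  have key := hasDerivAt_integral_of_dominated_loc_of_deriv_le (μ := μ) (𝕜 := ℝ)
    (F := fun ε s => φ (a s + 2 * ε * b s + ε^2 * c s) * (p s + ε * q s))
    (F' := fun ε s => deriv φ (a s + 2 * ε * b s + ε^2 * c s) * (2 * b s + 2 * ε * c s) *
      (p s + ε * q s) + φ (a s + 2 * ε * b s + ε^2 * c s) * q s)
    (x₀ := 0) (s := Metric.ball 0 1)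
    (bound := fun s => S2 * (4 * B) * (|p s| + |q s|) + S1 * |q s|)
    (Metric.ball_mem_nhds 0 one_pos) (Filter.Eventually.of_forall hmeas) ?_ ?_ ?_ hbi ?_
  · have h0 := key.2
    simp only [mul_zero, zero_mul, add_zero, ne_eq, OfNat.ofNat_ne_zero, not_false_eq_true,
      zero_pow] at h0
    exact h0
  · refine Integrable.mono' (hp.abs.const_mul S1) (hmeas 0) ?_
    filter_upwards [haB, hbB, hcB] with s h1 h2 h3
    have := hS1 _ (harg 0 s (by simp) h1 h2 h3)
    rw [Real.norm_eq_abs, abs_mul]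
    simp only [zero_mul, add_zero] at this ⊢
    exact mul_le_mul_of_nonneg_right this (abs_nonneg _)
  · have hba := (hb.const_mul 2).add (hc.const_mul (2 * 0))
    exact (((hφ'.comp_aestronglyMeasurable (hmeasArg 0)).mul hba).mul
      (hp.aestronglyMeasurable.add (hq.aestronglyMeasurable.const_mul 0))).add
      ((hφ.continuous.comp_aestronglyMeasurable (hmeasArg 0)).mul hq.aestronglyMeasurable)
  · filter_upwards [haB, hbB, hcB] with s h1 h2 h3 ε hε
    have hε' : |ε| ≤ 1 := by
      have := mem_ball_zero_iff.mp hε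
      rw [Real.norm_eq_abs] at this
      exact this.le
    have g1 := hS1 _ (harg ε s hε' h1 h2 h3)
    have g2 := hS2 _ (harg ε s hε' h1 h2 h3)
    have g3 : |2 * b s + 2 * ε * c s| ≤ 4 * B := by
      refine (abs_add_le _ _).trans ?_
      rw [abs_mul, abs_mul, abs_mul, abs_two]
      nlinarith [abs_nonneg ε, abs_nonneg (c s)]
    have g4 : |p s + ε * q s| ≤ |p s| + |q s| := by
      refine (abs_add_le _ _).trans ?_
      rw [abs_mul]
      nlinarith [abs_nonneg ε, abs_nonneg (q s)]
    rw [Real.norm_eq_abs]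
    refine (abs_add_le _ _).trans ?_
    rw [abs_mul, abs_mul, abs_mul]
    have hS20 : 0 ≤ S2 := (abs_nonneg _).trans g2
    have hB0 : 0 ≤ 4 * B := (abs_nonneg _).trans g3
    gcongr
  · refine Filter.Eventually.of_forall fun s ε _ => ?_
    have d1 : HasDerivAt (fun ε : ℝ => a s + 2 * ε * b s + ε^2 * c s)
        (2 * b s + 2 * ε * c s) ε := by
      have := (((hasDerivAt_id ε).const_mul 2).mul_const (b s)).const_add (a s) |>.add
        (((hasDerivAt_id ε).pow 2).mul_const (c s))
      exact this.congr_deriv (by simp)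
    have d2 : HasDerivAt (fun ε : ℝ => p s + ε * q s) (q s) ε := by
      simpa using ((hasDerivAt_id ε).mul_const (q s)).const_add (p s)
    have d3 := ((hφ.differentiable one_ne_zero _).hasDerivAt.comp ε d1).mul d2
    exact d3

/-- first-order condition (Euler–Lagrange-type representation) satisfied by
any minimizer `f ∈ H₀¹[0,1]` of the functional `𝓘ₓ`. -/
theorem minimizer_first_order_condition
    (K : ℝ → ℝ → ℝ) (c r : ℝ) (hc : 0 < c) (hr : 0 < r)
    (hKmeas : Measurable (Function.uncurry K))
    (hKint : ∀ t ∈ Icc (0:ℝ) 1, IntegrableOn (fun s => (K t s)^2) (Icc (0:ℝ) 1))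
    (CK : ℝ) (hKbdd : ∀ t ∈ Icc (0:ℝ) 1, (∫ s in Icc (0:ℝ) 1, (K t s)^2) ≤ CK)
    (hKmoc : ∀ t₁ ∈ Icc (0:ℝ) 1, ∀ t₂ ∈ Icc (0:ℝ) 1,
      (∫ s in Icc (0:ℝ) 1, (K t₁ s - K t₂ s)^2) ≤ c * |t₁ - t₂| ^ r)
    (hKvolterra : ∀ t s : ℝ, 0 ≤ t → t < s → s ≤ 1 → K t s = 0)
    (σ : ℝ → ℝ) (hσ : ContDiff ℝ 1 σ) (hσpos : ∀ x, 0 < σ x)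
    (ρ : ℝ) (hρ : ρ ∈ Ioo (-1:ℝ) 1) (x : ℝ)
    -- f ∈ H₀¹[0,1], encoded by an L² a.e. derivative df
    (f df : ℝ → ℝ)
    (hdfmeas : Measurable df) (hdfL2 : IntegrableOn (fun s => (df s)^2) (Icc (0:ℝ) 1))
    (hf : ∀ t ∈ Icc (0:ℝ) 1, f t = ∫ s in Icc (0:ℝ) t, df s)
    -- f minimizes 𝓘ₓ over H₀¹[0,1]
    (hmin : ∀ g dg : ℝ → ℝ, Measurable dg →
      IntegrableOn (fun s => (dg s)^2) (Icc (0:ℝ) 1) →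
      (∀ t ∈ Icc (0:ℝ) 1, g t = ∫ s in Icc (0:ℝ) t, dg s) →
      Ifun K σ ρ x f df ≤ Ifun K σ ρ x g dg) :
    ∀ t ∈ Icc (0:ℝ) 1,
      f t = ρ * (x - ρ * Gtil K σ f df) *
          ((∫ s in Icc (0:ℝ) t, σ (Kop K f f s)) +
            2 * ∫ s in Icc (0:ℝ) 1,
              deriv σ (Kop K f f s) * df s * Kop K f (fun u => min u t) s) /
          ((1 - ρ^2) * Ftil K σ f) +
        (x - ρ * Gtil K σ f df)^2 / ((1 - ρ^2) * (Ftil K σ f)^2) *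
          ∫ s in Icc (0:ℝ) 1,
            deriv (fun z => (σ z)^2) (Kop K f f s) * Kop K f (fun u => min u t) s := by
  intro t ht
  set μ := volume.restrict (Icc (0:ℝ) 1) with hμ
  set h : ℝ → ℝ := fun u => min u t with hh
  set dh : ℝ → ℝ := (Icc (0:ℝ) t).indicator 1 with hdh
  have hρ2 : 0 < 1 - ρ^2 := by nlinarith [hρ.1, hρ.2]
  -- integrability of df, dh
  have hdfint : Integrable df μ := by
    have : MemLp df 2 μ := (memLp_two_iff_integrable_sq hdfmeas.aestronglyMeasurable).2 hdfL2
    exact this.integrable (by norm_num)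
  have hdhmeas : Measurable dh := measurable_one.indicator measurableSet_Icc
  have hdhint : Integrable dh μ := (integrable_const (1:ℝ)).indicator measurableSet_Icc
  -- f
  have hfcont : ContinuousOn f (Icc (0:ℝ) 1) := by
    have := intervalIntegral.continuousOn_primitive_Icc (μ := volume) (f := df) (a := 0) (b := 1)
      hdfint
    exact this.congr hf
  have hfmeas : AEStronglyMeasurable f μ := hfcont.aestronglyMeasurable measurableSet_Icc
  obtain ⟨M0, hM0⟩ := isCompact_Icc.exists_bound_of_continuousOn hfcont
  simp only [Real.norm_eq_abs] at hM0
  have hhcont : Continuous h := continuous_id.min continuous_const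
  have hhmeas : AEStronglyMeasurable h μ := hhcont.aestronglyMeasurable
  have hhb : ∀ u ∈ Icc (0:ℝ) 1, |h u| ≤ 1 := fun u hu => by
    rw [abs_of_nonneg (le_min hu.1 ht.1)]
    exact (min_le_left _ _).trans hu.2
  have hM00 : 0 ≤ M0 := (abs_nonneg _).trans (hM0 0 (by simp))
  set M : ℝ := (M0 + 1)^2 with hM
  have hff : ∀ u ∈ Icc (0:ℝ) 1, |f u * f u| ≤ M := fun u hu => by
    rw [abs_mul]; have := hM0 u hu; nlinarith [abs_nonneg (f u)]
  have hfh : ∀ u ∈ Icc (0:ℝ) 1, |f u * h u| ≤ M := fun u hu => by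
    rw [abs_mul]; have := hM0 u hu; have := hhb u hu
    nlinarith [abs_nonneg (f u), abs_nonneg (h u)]
  have hhh : ∀ u ∈ Icc (0:ℝ) 1, |h u * h u| ≤ M := fun u hu => by
    rw [abs_mul]; have := hhb u hu
    nlinarith [abs_nonneg (h u)]
  have mff : AEStronglyMeasurable (fun u => f u * f u) μ := hfmeas.mul hfmeas
  have mfh : AEStronglyMeasurable (fun u => f u * h u) μ := hfmeas.mul hhmeas
  have mhh : AEStronglyMeasurable (fun u => h u * h u) μ := hhmeas.mul hhmeas
  have hmK : ∀ p q : ℝ → ℝ, AEStronglyMeasurable (fun u => p u * q u) μ →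
      AEStronglyMeasurable (Kop K p q) μ := by
    intro p q hpq
    refine (aux_measK K hKmeas _ hpq).aestronglyMeasurable.congr ?_
    filter_upwards [ae_restrict_mem measurableSet_Icc] with s hs
    exact (aux_KopEq K hKvolterra p q s hs).symm
  have hbK : ∀ p q : ℝ → ℝ, (∀ u ∈ Icc (0:ℝ) 1, |p u * q u| ≤ M) →
      ∀ᵐ s ∂μ, |Kop K p q s| ≤ (1 + CK) * M := by
    intro p q hpq
    filter_upwards [ae_restrict_mem measurableSet_Icc] with s hs
    rw [aux_KopEq K hKvolterra p q s hs]
    exact aux_boundK K hKmeas hKint CK hKbdd _ M hpq s hs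
  have hexp : ∀ ε : ℝ, ∀ s ∈ Icc (0:ℝ) 1,
      Kop K (fun u => f u + ε * h u) (fun u => f u + ε * h u) s =
        Kop K f f s + 2 * ε * Kop K f h s + ε^2 * Kop K h h s := by
    intro ε s hs
    simp only [aux_KopEq K hKvolterra _ _ s hs]
    have i1 := aux_intK K hKmeas hKint _ M mff hff s hs
    have i2 := (aux_intK K hKmeas hKint _ M mfh hfh s hs).const_mul (2 * ε)
    have i3 := (aux_intK K hKmeas hKint _ M mhh hhh s hs).const_mul (ε^2)
    have i12 : Integrable (fun u => K s u * (f u * f u) + 2 * ε * (K s u * (f u * h u)))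
        (volume.restrict (Icc (0:ℝ) 1)) := Integrable.add i1 i2
    rw [← integral_const_mul, ← integral_const_mul, ← integral_add i1 i2,
      ← integral_add i12 i3]
    congr 1
    funext u
    ring
  have hG := aux_deriv μ σ hσ (Kop K f f) (Kop K f h) (Kop K h h) df dh _
    (hmK _ _ mff) (hmK _ _ mfh) (hmK _ _ mhh) (hbK _ _ hff) (hbK _ _ hfh) (hbK _ _ hhh)
    hdfint hdhint
  have hF := aux_deriv μ (fun z => σ z ^ 2) (hσ.pow 2) (Kop K f f) (Kop K f h) (Kop K h h)
    (fun _ => 1) (fun _ => 0) _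
    (hmK _ _ mff) (hmK _ _ mfh) (hmK _ _ mhh) (hbK _ _ hff) (hbK _ _ hfh) (hbK _ _ hhh)
    (integrable_const _) (integrable_const _)
  have hGe : ∀ ε : ℝ, Gtil K σ (fun u => f u + ε * h u) (fun u => df u + ε * dh u) =
      ∫ s, σ (Kop K f f s + 2 * ε * Kop K f h s + ε^2 * Kop K h h s) * (df s + ε * dh s) ∂μ := by
    intro ε
    refine setIntegral_congr_fun measurableSet_Icc fun s hs => ?_
    simp only [hexp ε s hs]
  have hFe : ∀ ε : ℝ, Ftil K σ (fun u => f u + ε * h u) =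
      ∫ s, (fun z => σ z ^ 2) (Kop K f f s + 2 * ε * Kop K f h s + ε^2 * Kop K h h s) *
        ((fun _ => 1) s + ε * (fun _ => 0) s) ∂μ := by
    intro ε
    refine setIntegral_congr_fun measurableSet_Icc fun s hs => ?_
    simp only [hexp ε s hs, mul_zero, add_zero, mul_one]
  simp only [← hGe] at hG
  simp only [← hFe] at hF
  -- E
  have hdfdh : Integrable (fun s => df s * dh s) μ := by
    have : (fun s => df s * dh s) = (Icc (0:ℝ) t).indicator df := by
      funext s; by_cases hs : s ∈ Icc (0:ℝ) t <;> simp [hdh, hs]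
    rw [this]
    exact hdfint.indicator measurableSet_Icc
  have hdh2 : (fun s => dh s ^ 2) = dh := by
    funext s; by_cases hs : s ∈ Icc (0:ℝ) t <;> simp [hdh, hs]
  have hinter : Icc (0:ℝ) t ∩ Icc 0 1 = Icc 0 t :=
    inter_eq_left.2 (Icc_subset_Icc_right ht.2)
  have hdfdhv : ∫ s, df s * dh s ∂μ = f t := by
    have : (fun s => df s * dh s) = (Icc (0:ℝ) t).indicator df := by
      funext s; by_cases hs : s ∈ Icc (0:ℝ) t <;> simp [hdh, hs]
    rw [this, integral_indicator measurableSet_Icc, hμ, Measure.restrict_restrict measurableSet_Icc,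
      hinter, hf t ht]
  have hsq : ∀ ε : ℝ, (fun s => (df s + ε * dh s)^2) =
      fun s => (df s ^ 2 + 2 * ε * (df s * dh s)) + ε^2 * dh s := by
    intro ε; funext s
    have := congrFun hdh2 s
    linear_combination ε^2 * this
  have hEi : ∀ ε : ℝ, IntegrableOn (fun s => (df s + ε * dh s)^2) (Icc 0 1) := by
    intro ε
    rw [hsq ε]
    exact (Integrable.add hdfL2 (hdfdh.const_mul _)).add (hdhint.const_mul _)
  have hEe : ∀ ε : ℝ, Etil (fun u => df u + ε * dh u) =
      Etil df + 2 * ε * f t + ε^2 * ∫ s, dh s ∂μ := by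
    intro ε
    unfold Etil
    have i12 : Integrable (fun s => df s ^ 2 + 2 * ε * (df s * dh s)) μ :=
      Integrable.add hdfL2 (hdfdh.const_mul _)
    rw [hsq ε, integral_add i12 (hdhint.const_mul _),
      integral_add hdfL2 (hdfdh.const_mul _), integral_const_mul, integral_const_mul, hdfdhv]
  have hE : HasDerivAt (fun ε : ℝ => Etil (fun u => df u + ε * dh u)) (2 * f t) 0 := by
    simp only [hEe]
    have := ((((hasDerivAt_id (0:ℝ)).const_mul 2).mul_const (f t)).const_add (Etil df)).add
      (((hasDerivAt_id (0:ℝ)).pow 2).mul_const (∫ s, dh s ∂μ))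
    exact this.congr_deriv (by simp)
  -- admissibility
  have hprim : ∀ s ∈ Icc (0:ℝ) 1, h s = ∫ u in Icc (0:ℝ) s, dh u := by
    intro s hs
    rw [hdh, integral_indicator measurableSet_Icc, Measure.restrict_restrict measurableSet_Icc,
      Icc_inter_Icc]
    simp [hh, min_comm, hs.1, ht.1]
  have hlm : ∀ ε : ℝ, Ifun K σ ρ x f df ≤
      Ifun K σ ρ x (fun u => f u + ε * h u) (fun u => df u + ε * dh u) := by
    intro ε
    refine hmin _ _ (hdfmeas.add (hdhmeas.const_mul _)) (hEi ε) ?_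
    intro s hs
    have hsub : Icc (0:ℝ) s ⊆ Icc 0 1 := Icc_subset_Icc_right hs.2
    have j1 : IntegrableOn df (Icc 0 s) := IntegrableOn.mono_set hdfint hsub
    have j2 : IntegrableOn dh (Icc 0 s) := IntegrableOn.mono_set hdhint hsub
    rw [integral_add j1 (j2.const_mul _), integral_const_mul, ← hprim s hs, hf s hs]
  have hG0 : Gtil K σ (fun u => f u + 0 * h u) (fun u => df u + 0 * dh u) = Gtil K σ f df := by
    simp
  have hF0 : Ftil K σ (fun u => f u + 0 * h u) = Ftil K σ f := by simp
  -- positivity of F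
  have hbσ : ∀ φ : ℝ → ℝ, Continuous φ → ∃ S, ∀ᵐ s ∂μ, ‖φ (Kop K f f s)‖ ≤ S := by
    intro φ hφ
    obtain ⟨S, hS⟩ := (isCompact_Icc (a := -((1 + CK) * M)) (b := (1 + CK) * M)).exists_bound_of_continuousOn
      hφ.continuousOn
    refine ⟨S, ?_⟩
    filter_upwards [hbK _ _ hff] with s hs
    exact hS _ (abs_le.1 hs)
  have hiφ : ∀ φ : ℝ → ℝ, Continuous φ → ∀ p : ℝ → ℝ, Integrable p μ →
      Integrable (fun s => φ (Kop K f f s) * p s) μ := by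
    intro φ hφ p hp
    obtain ⟨S, hS⟩ := hbσ φ hφ
    exact hp.bdd_mul (hφ.comp_aestronglyMeasurable (hmK _ _ mff)) hS
  have hFpos : 0 < Ftil K σ f := by
    have hi : Integrable (fun s => σ (Kop K f f s) ^ 2) μ := by
      have := hiφ (fun z => σ z ^ 2) (hσ.continuous.pow 2) (fun _ => 1) (integrable_const _)
      simpa using this
    unfold Ftil
    rw [integral_pos_iff_support_of_nonneg (fun s => sq_nonneg _) hi]
    have : Function.support (fun s => σ (Kop K f f s) ^ 2) = univ := by
      ext s; simp [(hσpos (Kop K f f s)).ne']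
    rw [this, Measure.restrict_apply_univ]; simp
  -- derivative of the functional
  have hI := ((((hG.const_mul ρ).const_sub x).pow 2).div (hF.const_mul (2 * (1 - ρ^2)))
    (by rw [hF0]; positivity)).add (hE.const_mul (1/2))
  have hmin0 : IsLocalMin (fun ε : ℝ =>
      Ifun K σ ρ x (fun u => f u + ε * h u) (fun u => df u + ε * dh u)) 0 := by
    refine Filter.Eventually.of_forall fun ε => ?_
    have := hlm ε
    simpa using this
  have hz := hmin0.hasDerivAt_eq_zero hI
  simp only [Pi.pow_apply, hG0, hF0] at hz
  have hv1 : ∫ s, (deriv σ (Kop K f f s) * (2 * Kop K f h s) * df s + σ (Kop K f f s) * dh s) ∂μ =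
      (∫ s in Icc (0:ℝ) t, σ (Kop K f f s)) +
            2 * ∫ s, deriv σ (Kop K f f s) * df s * Kop K f h s ∂μ := by
    have k1 : Integrable (fun s => σ (Kop K f f s) * dh s) μ := hiφ σ hσ.continuous dh hdhint
    have k2 : Integrable (fun s => deriv σ (Kop K f f s) * (2 * Kop K f h s) * df s) μ := by
      have := (hiφ _ (hσ.continuous_deriv le_rfl) df hdfint).bdd_mul
        (hmK _ _ mfh) (hbK _ _ hfh) |>.const_mul 2
      refine this.congr (Filter.Eventually.of_forall fun s => ?_)
      simp only; ring
    rw [integral_add k2 k1, ← integral_const_mul, add_comm]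
    congr 1
    · have : (fun s => σ (Kop K f f s) * dh s) =
          (Icc (0:ℝ) t).indicator (fun s => σ (Kop K f f s)) := by
        funext s; by_cases hs : s ∈ Icc (0:ℝ) t <;> simp [hdh, hs]
      rw [this, integral_indicator measurableSet_Icc, hμ,
        Measure.restrict_restrict measurableSet_Icc, hinter]
    · congr 1; funext s; ring
  have hv2 : ∫ s, (deriv (fun z => σ z ^ 2) (Kop K f f s) * (2 * Kop K f h s) * 1 +
      σ (Kop K f f s) ^ 2 * 0) ∂μ =
      2 * ∫ s, deriv (fun z => σ z ^ 2) (Kop K f f s) * Kop K f h s ∂μ := by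
    rw [← integral_const_mul]
    congr 1; funext s; ring
  rw [hv1, hv2] at hz
  generalize (∫ s in Icc (0:ℝ) t, σ (Kop K f f s)) +
            2 * ∫ s, deriv σ (Kop K f f s) * df s * Kop K f h s ∂μ = A at hz ⊢
  generalize ∫ s, deriv (fun z => σ z ^ 2) (Kop K f f s) * Kop K f h s ∂μ = D at hz ⊢
  generalize Ftil K σ f = F at hz hFpos ⊢
  generalize Gtil K σ f df = G at hz ⊢
  generalize 1 - ρ^2 = R at hz hρ2 ⊢
  have hFn := hFpos.ne'
  have hRn := hρ2.ne'
  simp only [Nat.cast_ofNat, Nat.add_one_sub_one, pow_one] at hz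
  field_simp at hz ⊢
  linear_combination hz
end

section
/- Work on [0,1] with a kernel K satisfying Assumption (K), let σ : ℝ → (0,∞) be infinitely differentiable, ρ ∈ (−1,1), ρ̄ := √(1−ρ²), σ₀ := σ(0), and define the rate function I(x) := inf_{f ∈ H₀¹[0,1]} [ (x − ρ G̃(f))² / (2 ρ̄² F̃(f)) + ½ Ẽ(f) ], where Ẽ(f) := ∫₀¹ ḟ(s)² ds, F̃(f) := ∫₀¹ σ(𝒦(f²)(s))² ds, and G̃(f) := ∫₀¹ σ(𝒦(f²)(s)) ḟ(s) ds. Assume that I is three times continuously differentiable on a neighborhood of 0. Then I(x) = x²/(2σ₀²) + O(x³) as x → 0; that is, there exist constants δ > 0 and C > 0 such that |I(x) − x²/(2σ₀²)| ≤ C |x|³ for all |x| ≤ δ. In particular I(0) = 0, I′(0) = 0 and I″(0) = 1/σ₀². -/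
open MeasureTheory Set

/-- The rate function
`I(x) = inf_{f ∈ H₀¹[0,1]} [ (x − ρG̃(f))²/(2ρ̄²F̃(f)) + ½Ẽ(f) ]`. -/
noncomputable def rateFun (K : ℝ → ℝ → ℝ) (σ : ℝ → ℝ) (ρ : ℝ) (x : ℝ) : ℝ :=
  sInf {y : ℝ | ∃ f df : ℝ → ℝ, Measurable df ∧
    IntegrableOn (fun s => (df s)^2) (Icc (0:ℝ) 1) ∧
    (∀ t ∈ Icc (0:ℝ) 1, f t = ∫ s in Icc (0:ℝ) t, df s) ∧
    y = (x - ρ * Gtil K σ f df)^2 / (2 * (1 - ρ^2) * Ftil K σ f) + (1/2) * Etil df}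


theorem aux_cs (h : ℝ → ℝ) (hm : AEStronglyMeasurable h (volume.restrict (Icc (0:ℝ) 1)))
    (hi : IntegrableOn (fun s => (h s)^2) (Icc (0:ℝ) 1)) :
    IntegrableOn h (Icc (0:ℝ) 1) ∧
    (∫ s in Icc (0:ℝ) 1, |h s|)^2 ≤ ∫ s in Icc (0:ℝ) 1, (h s)^2 := by
  have h1 : IntegrableOn h (Icc (0:ℝ) 1) := by
    have h2 : IntegrableOn (fun s => 1 + (h s)^2) (Icc (0:ℝ) 1) :=
      (integrable_const (1:ℝ)).add hi
    refine Integrable.mono' h2 hm (Filter.Eventually.of_forall fun s => ?_)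
    rw [Real.norm_eq_abs, abs_le]
    constructor <;> nlinarith [sq_nonneg (h s - 1), sq_nonneg (h s + 1)]
  refine ⟨h1, ?_⟩
  set m := ∫ s in Icc (0:ℝ) 1, |h s| with hmdef
  have habs : IntegrableOn (fun s => |h s|) (Icc (0:ℝ) 1) := h1.abs
  have h3 : 0 ≤ ∫ s in Icc (0:ℝ) 1, ((h s)^2 - 2 * m * |h s| + m^2) := by
    refine integral_nonneg fun s => ?_
    have := sq_nonneg (|h s| - m)
    have h4 := sq_abs (h s)
    simp only [Pi.zero_apply]
    nlinarith
  have hj : IntegrableOn (fun s => 2 * m * |h s|) (Icc (0:ℝ) 1) := habs.const_mul _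
  have hk : IntegrableOn (fun s => (h s)^2 - 2 * m * |h s|) (Icc (0:ℝ) 1) := hi.sub hj
  rw [integral_add hk (integrable_const _), integral_sub hi hj, integral_const_mul,
    ← hmdef] at h3
  simp at h3
  nlinarith

theorem aux_taylor (I : ℝ → ℝ) (a C δ : ℝ) (hδ : 0 < δ)
    (hb : ∀ x : ℝ, |x| ≤ δ → |I x - x^2 * a| ≤ C * |x|^3)
    (hs : ∃ u ∈ nhds (0:ℝ), ContDiffOn ℝ 3 I u) :
    I 0 = 0 ∧ deriv I 0 = 0 ∧ iteratedDeriv 2 I 0 = 2 * a := by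
  obtain ⟨u, hu, hI⟩ := hs
  have hc : ContDiffAt ℝ 2 I 0 := (hI.contDiffAt hu).of_le (by norm_num)
  have h0 : I 0 = 0 := by
    have := hb 0 (by simpa using hδ.le)
    simpa using this
  have hev : ∀ᶠ x in nhds (0:ℝ), |x| ≤ δ := by
    have : Metric.ball (0:ℝ) δ ∈ nhds (0:ℝ) := Metric.ball_mem_nhds _ hδ
    filter_upwards [this] with x hx
    simpa using (Metric.mem_ball.mp hx).le
  have hO : (fun x => I x - x^2 * a) =O[nhds 0] fun x : ℝ => x^3 := by
    refine Asymptotics.IsBigO.of_bound C ?_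
    filter_upwards [hev] with x hx
    simpa [abs_pow] using hb x hx
  have h32 : (fun x : ℝ => x^3) =o[nhds 0] fun x : ℝ => x^2 :=
    Asymptotics.isLittleO_pow_pow (by norm_num)
  have h21 : (fun x : ℝ => x^2) =o[nhds 0] fun x : ℝ => x := by
    simpa using Asymptotics.isLittleO_pow_pow (𝕜 := ℝ) (m := 1) (n := 2) (by norm_num)
  have ho := hO.trans_isLittleO h32
  have hd : deriv I 0 = 0 := by
    refine HasDerivAt.deriv ?_
    rw [hasDerivAt_iff_isLittleO]
    simp only [h0, sub_zero, smul_zero]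
    have h5 : (fun x : ℝ => x^2 * a) =o[nhds 0] fun x : ℝ => x := by
      simpa [mul_comm] using h21.const_mul_left a
    simpa using (ho.trans h21).add h5
  refine ⟨h0, hd, ?_⟩
  obtain ⟨ε, hε, hball⟩ := Metric.mem_nhds_iff.mp hu
  have hbo : IsOpen (Metric.ball (0:ℝ) ε) := Metric.isOpen_ball
  have h0m : (0:ℝ) ∈ Metric.ball (0:ℝ) ε := Metric.mem_ball_self hε
  have hT := taylor_isLittleO (n := 2) (convex_ball (0:ℝ) ε) h0m
    ((hI.mono hball).of_le (by norm_num))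
  rw [hbo.nhdsWithin_eq h0m] at hT
  simp only [taylorWithinEval_succ, taylor_within_zero_eval,
    iteratedDerivWithin_of_isOpen hbo h0m, sub_zero, h0, zero_add, smul_eq_mul,
    iteratedDeriv_one, hd] at hT
  set d := iteratedDeriv 2 I 0 with hdd
  norm_num at hT
  have h6 := ho.sub hT
  have h7 : (fun x : ℝ => (1/2 * d - a) * x^2) =o[nhds 0] fun x : ℝ => x^2 := by
    refine h6.congr_left fun x => ?_
    ring
  by_contra hne
  have hq : (1/2 * d - a) ≠ 0 := fun h => hne (by linarith)
  have h8 := (Asymptotics.isLittleO_const_mul_left_iff hq).mp h7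
  have h9 := h8.bound (c := 1/2) (by norm_num)
  obtain ⟨e, he, h10⟩ := Metric.eventually_nhds_iff.mp h9
  have h11 := h10 (y := e/2) (by rw [dist_zero_right, Real.norm_eq_abs, abs_of_pos] <;> linarith)
  rw [Real.norm_eq_abs, abs_of_pos (by positivity)] at h11
  have : 0 < (e/2)^2 := by positivity
  linarith


theorem aux_alg (u u0 F s A B x : ℝ) (hs : 0 < s) (hA : 0 ≤ A) (hx : |x| ≤ 1)
    (h1 : |u - u0| ≤ A * |x|^2) (h2 : |u0| ≤ 2 * |x|) (h3 : |F - s^2| ≤ B * |x|)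
    (h4 : s^2/2 ≤ F) :
    |u^2 / F - u0^2 / s^2| ≤ (A * (A + 4) * s^2 + 4 * B) / (s^4 / 2) * |x|^3 := by
  have hF : 0 < F := by nlinarith [pow_pos hs 2]
  have hx0 := abs_nonneg x
  have e1 : u^2 / F - u0^2 / s^2 = ((u - u0) * (u + u0) * s^2 + u0^2 * (s^2 - F)) / (F * s^2) := by
    field_simp
    ring
  have h5 : |u + u0| ≤ (A + 4) * |x| := by
    have : u + u0 = (u - u0) + 2 * u0 := by ring
    rw [this]
    refine (abs_add_le _ _).trans ?_
    rw [abs_mul, abs_two]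
    nlinarith [mul_nonneg hA hx0, mul_nonneg (mul_nonneg hA hx0) (sub_nonneg.2 hx)]
  have h6 : |(u - u0) * (u + u0) * s^2 + u0^2 * (s^2 - F)|
      ≤ (A * (A + 4) * s^2 + 4 * B) * |x|^3 := by
    refine (abs_add_le _ _).trans ?_
    rw [abs_mul, abs_mul, abs_mul, abs_of_pos (pow_pos hs 2), abs_pow, abs_sub_comm (s^2) F]
    have h7 : |u - u0| * |u + u0| ≤ (A * |x|^2) * ((A + 4) * |x|) := by gcongr
    have h8 : |u0|^2 * |F - s^2| ≤ (2 * |x|)^2 * (B * |x|) := by gcongr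
    nlinarith [mul_le_mul_of_nonneg_right h7 (pow_pos hs 2).le]
  rw [e1, abs_div, abs_of_pos (by positivity : 0 < F * s^2), div_mul_eq_mul_div]
  have h9 : s^4/2 ≤ F * s^2 := by nlinarith [pow_pos hs 2]
  exact div_le_div₀ ((abs_nonneg _).trans h6) h6 (by positivity) h9

/-- the value of the unperturbed quadratic problem -/
theorem aux_quad (x g s ρ : ℝ) (hs : 0 < s) (hρ : 0 < 1 - ρ^2) :
    x^2 / (2 * s^2) ≤ (x - ρ * (s * g))^2 / s^2 * (1 / (2 * (1 - ρ^2))) + 1/2 * g^2 := by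
  have : (x - ρ * (s * g))^2 / s^2 * (1 / (2 * (1 - ρ^2))) + 1/2 * g^2 - x^2 / (2 * s^2)
      = (s * g - ρ * x)^2 / (2 * s^2 * (1 - ρ^2)) := by
    field_simp
    ring
  have h2 : 0 ≤ (s * g - ρ * x)^2 / (2 * s^2 * (1 - ρ^2)) := by positivity
  linarith

theorem aux_df (f df : ℝ → ℝ) (b : ℝ) (hb : 0 ≤ b) (hm : Measurable df)
    (hi : IntegrableOn (fun s => (df s)^2) (Icc (0:ℝ) 1))
    (hf : ∀ t ∈ Icc (0:ℝ) 1, f t = ∫ s in Icc (0:ℝ) t, df s)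
    (hE : (∫ s in Icc (0:ℝ) 1, (df s)^2) ≤ b^2) :
    IntegrableOn df (Icc (0:ℝ) 1) ∧ (∫ s in Icc (0:ℝ) 1, |df s|) ≤ b ∧
    ContinuousOn f (Icc 0 1) ∧ ∀ t ∈ Icc (0:ℝ) 1, |f t| ≤ b := by
  obtain ⟨h1, h2⟩ := aux_cs df hm.aestronglyMeasurable hi
  have h3 : (∫ s in Icc (0:ℝ) 1, |df s|) ≤ b := abs_le_of_sq_le_sq' (h2.trans hE) hb |>.2
  refine ⟨h1, h3, ?_, ?_⟩
  · exact (intervalIntegral.continuousOn_primitive_Icc h1).congr hf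
  · intro t ht
    rw [hf t ht]
    refine (abs_integral_le_integral_abs).trans (le_trans ?_ h3)
    exact setIntegral_mono_set h1.abs (Filter.Eventually.of_forall fun _ => abs_nonneg _)
      (Icc_subset_Icc_right ht.2).eventuallyLE

theorem aux_kernel (K : ℝ → ℝ → ℝ) (c r : ℝ) (hr : 0 < r)
    (hKmeas : Measurable (Function.uncurry K))
    (hKint : ∀ t ∈ Icc (0:ℝ) 1, IntegrableOn (fun s => (K t s)^2) (Icc (0:ℝ) 1))
    (CK : ℝ) (hKbdd : ∀ t ∈ Icc (0:ℝ) 1, (∫ s in Icc (0:ℝ) 1, (K t s)^2) ≤ CK)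
    (hKmoc : ∀ t₁ ∈ Icc (0:ℝ) 1, ∀ t₂ ∈ Icc (0:ℝ) 1,
      (∫ s in Icc (0:ℝ) 1, (K t₁ s - K t₂ s)^2) ≤ c * |t₁ - t₂| ^ r)
    (hKvolterra : ∀ t s : ℝ, 0 ≤ t → t < s → s ≤ 1 → K t s = 0)
    (f : ℝ → ℝ) (b : ℝ) (hfc : ContinuousOn f (Icc 0 1))
    (hfb : ∀ t ∈ Icc (0:ℝ) 1, |f t| ≤ b) :
    (∀ t ∈ Icc (0:ℝ) 1, |Kop K f f t| ≤ (1 + CK) / 2 * b^2) ∧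
    ContinuousOn (Kop K f f) (Icc 0 1) := by
  have hKm : ∀ t, Measurable (K t) := fun t => hKmeas.of_uncurry_left
  have hK1 : ∀ t ∈ Icc (0:ℝ) 1, IntegrableOn (K t) (Icc (0:ℝ) 1) := fun t ht =>
    (aux_cs (K t) (hKm t).aestronglyMeasurable (hKint t ht)).1
  have hff : ∀ s ∈ Icc (0:ℝ) 1, |f s * f s| ≤ b^2 := by
    intro s hs
    rw [abs_mul, sq]
    exact mul_self_le_mul_self (abs_nonneg _) (hfb s hs)
  have hffm : AEStronglyMeasurable (fun s => f s * f s) (volume.restrict (Icc (0:ℝ) 1)) :=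
    (hfc.mul hfc).aestronglyMeasurable measurableSet_Icc
  have hint : ∀ t ∈ Icc (0:ℝ) 1, IntegrableOn (fun s => K t s * (f s * f s)) (Icc (0:ℝ) 1) := by
    intro t ht
    refine Integrable.mul_bdd (c := b^2) (hK1 t ht) hffm ?_
    filter_upwards [ae_restrict_mem measurableSet_Icc] with s hs using hff s hs
  have heq : ∀ t ∈ Icc (0:ℝ) 1, Kop K f f t = ∫ s in Icc (0:ℝ) 1, K t s * (f s * f s) := by
    intro t ht
    refine (setIntegral_eq_of_subset_of_forall_sdiff_eq_zero measurableSet_Icc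
      (Icc_subset_Icc_right ht.2) ?_).symm
    intro s hs
    have : t < s := by
      by_contra h
      exact hs.2 ⟨hs.1.1, not_lt.mp h⟩
    rw [hKvolterra t s ht.1 this hs.1.2, zero_mul]
  constructor
  · intro t ht
    rw [heq t ht]
    have h1 : IntegrableOn (fun s => (1 + (K t s)^2) / 2 * b^2) (Icc (0:ℝ) 1) :=
      (((integrable_const (1:ℝ)).add (hKint t ht)).div_const 2).mul_const _
    have h2 := norm_integral_le_of_norm_le (f := fun s => K t s * (f s * f s)) h1 (by
      filter_upwards [ae_restrict_mem measurableSet_Icc] with s hs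
      rw [Real.norm_eq_abs, abs_mul]
      refine mul_le_mul ?_ (hff s hs) (abs_nonneg _) (by positivity)
      rw [abs_le]
      constructor <;> nlinarith [sq_nonneg (K t s - 1), sq_nonneg (K t s + 1)])
    rw [Real.norm_eq_abs] at h2
    refine h2.trans ?_
    rw [integral_mul_const, integral_div, integral_add (integrable_const _) (hKint t ht)]
    have := hKbdd t ht
    simp only [integral_const, measureReal_restrict_apply_univ, Real.volume_real_Icc]
    norm_num
    gcongr
  · intro t ht
    have hbound : ∀ t' ∈ Icc (0:ℝ) 1,
        |Kop K f f t' - Kop K f f t| ≤ Real.sqrt (c * |t' - t| ^ r) * b^2 := by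
      intro t' ht'
      rw [heq t ht, heq t' ht', ← integral_sub (hint t' ht') (hint t ht)]
      have hd2 : IntegrableOn (fun s => (K t' s - K t s)^2) (Icc (0:ℝ) 1) := by
        have h3 : IntegrableOn (fun s => 2 * (K t' s)^2 + 2 * (K t s)^2) (Icc (0:ℝ) 1) :=
          ((hKint t' ht').const_mul 2).add ((hKint t ht).const_mul 2)
        refine Integrable.mono' h3 (((hKm t').sub (hKm t)).pow_const 2).aestronglyMeasurable
          (Filter.Eventually.of_forall fun s => ?_)
        rw [Real.norm_eq_abs, abs_of_nonneg (sq_nonneg _)]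
        nlinarith [sq_nonneg (K t' s + K t s)]
      obtain ⟨h4, h5⟩ := aux_cs (fun s => K t' s - K t s)
        ((hKm t').sub (hKm t)).aestronglyMeasurable hd2
      have h6 := Real.le_sqrt_of_sq_le (h5.trans (hKmoc t' ht' t ht))
      have h7 : IntegrableOn (fun s => |K t' s - K t s| * b^2) (Icc (0:ℝ) 1) :=
        h4.abs.mul_const _
      have h8 := norm_integral_le_of_norm_le
        (f := fun s => K t' s * (f s * f s) - K t s * (f s * f s)) h7 (by
        filter_upwards [ae_restrict_mem measurableSet_Icc] with s hs
        rw [← sub_mul, Real.norm_eq_abs, abs_mul]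
        exact mul_le_mul_of_nonneg_left (hff s hs) (abs_nonneg _))
      rw [integral_mul_const] at h8
      exact h8.trans (mul_le_mul_of_nonneg_right h6 (sq_nonneg _))
    rw [ContinuousWithinAt, tendsto_iff_norm_sub_tendsto_zero]
    refine squeeze_zero' (Filter.Eventually.of_forall fun _ => norm_nonneg _)
      (g := fun t' => Real.sqrt (c * |t' - t| ^ r) * b^2) ?_ ?_
    · filter_upwards [self_mem_nhdsWithin] with t' ht' using hbound t' ht'
    · have hcont : Continuous fun t' : ℝ => Real.sqrt (c * |t' - t| ^ r) * b^2 := by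
        have : Continuous fun t' : ℝ => |t' - t| ^ r :=
          (continuous_abs.comp (continuous_id.sub continuous_const)).rpow_const
            (fun _ => Or.inr hr.le)
        exact (Real.continuous_sqrt.comp (continuous_const.mul this)).mul continuous_const
      have h9 := (hcont.tendsto t).mono_left (nhdsWithin_le_nhds (s := Icc (0:ℝ) 1))
      simpa [Real.zero_rpow hr.ne'] using h9

/-- bounds on `F̃` and `G̃` when `σ ∘ 𝒦(f²)` is uniformly close to `s`. -/
theorem aux_FG (K : ℝ → ℝ → ℝ) (σ f df : ℝ → ℝ) (s ε b : ℝ) (hs : 0 < s) (hε : 0 ≤ ε)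
    (hεs : ε ≤ s) (hσ : Continuous σ) (hK : ContinuousOn (Kop K f f) (Icc 0 1))
    (hdf : IntegrableOn df (Icc (0:ℝ) 1)) (hb : (∫ t in Icc (0:ℝ) 1, |df t|) ≤ b)
    (h : ∀ t ∈ Icc (0:ℝ) 1, |σ (Kop K f f t) - s| ≤ ε) :
    |Ftil K σ f - s^2| ≤ 3 * s * ε ∧
    |Gtil K σ f df - s * ∫ t in Icc (0:ℝ) 1, df t| ≤ ε * b := by
  have hc : ContinuousOn (fun t => σ (Kop K f f t)) (Icc 0 1) := hσ.comp_continuousOn hK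
  have hw : ∀ t ∈ Icc (0:ℝ) 1, |σ (Kop K f f t)| ≤ 2 * s := by
    intro t ht
    have := abs_le.mp (h t ht)
    rw [abs_le]; constructor <;> linarith
  constructor
  · have h1 : Ftil K σ f - s^2 = ∫ t in Icc (0:ℝ) 1, ((σ (Kop K f f t))^2 - s^2) := by
      have h0 : IntegrableOn (fun t => (σ (Kop K f f t))^2) (Icc (0:ℝ) 1) :=
        (hc.pow 2).integrableOn_compact isCompact_Icc
      rw [integral_sub h0 (integrable_const _)]
      simp [Ftil]
    rw [h1]
    have h2 := norm_setIntegral_le_of_norm_le_const (μ := volume) (s := Icc (0:ℝ) 1)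
      (f := fun t => (σ (Kop K f f t))^2 - s^2) (C := 3 * s * ε) measure_Icc_lt_top (by
      intro t ht
      have e : (σ (Kop K f f t))^2 - s^2 = (σ (Kop K f f t) + s) * (σ (Kop K f f t) - s) := by ring
      rw [e, Real.norm_eq_abs, abs_mul]
      refine mul_le_mul ?_ (h t ht) (abs_nonneg _) (by positivity)
      refine (abs_add_le _ _).trans ?_
      rw [abs_of_pos hs]
      linarith [hw t ht])
    simpa using h2
  · have hi : IntegrableOn (fun t => σ (Kop K f f t) * df t) (Icc (0:ℝ) 1) := by
      refine Integrable.bdd_mul (c := 2 * s) hdf (hc.aestronglyMeasurable measurableSet_Icc) ?_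
      filter_upwards [ae_restrict_mem measurableSet_Icc] with t ht using hw t ht
    have h1 : Gtil K σ f df - s * (∫ t in Icc (0:ℝ) 1, df t)
        = ∫ t in Icc (0:ℝ) 1, (σ (Kop K f f t) * df t - s * df t) := by
      rw [integral_sub hi (hdf.const_mul s), integral_const_mul]
      rfl
    rw [h1]
    have h7 : IntegrableOn (fun t => ε * |df t|) (Icc (0:ℝ) 1) := hdf.abs.const_mul _
    have h8 := norm_integral_le_of_norm_le
        (f := fun t => σ (Kop K f f t) * df t - s * df t) h7 (by
        filter_upwards [ae_restrict_mem measurableSet_Icc] with t ht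
        rw [← sub_mul, Real.norm_eq_abs, abs_mul]
        exact mul_le_mul_of_nonneg_right (h t ht) (abs_nonneg _))
    rw [integral_const_mul] at h8
    exact h8.trans (mul_le_mul_of_nonneg_left hb hε)

set_option maxHeartbeats 1000000 in
theorem rate_bound
    (K : ℝ → ℝ → ℝ) (c r : ℝ) (hr : 0 < r)
    (hKmeas : Measurable (Function.uncurry K))
    (hKint : ∀ t ∈ Icc (0:ℝ) 1, IntegrableOn (fun s => (K t s)^2) (Icc (0:ℝ) 1))
    (CK : ℝ) (hKbdd : ∀ t ∈ Icc (0:ℝ) 1, (∫ s in Icc (0:ℝ) 1, (K t s)^2) ≤ CK)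
    (hKmoc : ∀ t₁ ∈ Icc (0:ℝ) 1, ∀ t₂ ∈ Icc (0:ℝ) 1,
      (∫ s in Icc (0:ℝ) 1, (K t₁ s - K t₂ s)^2) ≤ c * |t₁ - t₂| ^ r)
    (hKvolterra : ∀ t s : ℝ, 0 ≤ t → t < s → s ≤ 1 → K t s = 0)
    (σ : ℝ → ℝ) (hσ : ContDiff ℝ (⊤ : ℕ∞) σ) (hσpos : ∀ x, 0 < σ x)
    (ρ : ℝ) (hρ : ρ ∈ Ioo (-1:ℝ) 1) :
    ∃ δ : ℝ, 0 < δ ∧ ∃ C : ℝ, 0 < C ∧ ∀ x : ℝ, |x| ≤ δ →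
      |rateFun K σ ρ x - x^2 / (2 * (σ 0)^2)| ≤ C * |x|^3 := by
  have hs := hσpos 0
  set s := σ 0 with hsdef
  have hρ2 : 0 < 1 - ρ^2 := by nlinarith [hρ.1, hρ.2]
  have hρ1 : |ρ| ≤ 1 := abs_le.mpr ⟨hρ.1.le, hρ.2.le⟩
  have hCK : 0 ≤ CK := by
    refine le_trans ?_ (hKbdd 0 (by simp))
    exact integral_nonneg fun _ => sq_nonneg _
  obtain ⟨k, hk, hkdef⟩ : ∃ k : ℝ, 0 < k ∧ k = (1 + CK) / 2 := ⟨_, by positivity, rfl⟩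
  obtain ⟨L, hL, η, hη, hLη⟩ : ∃ L : ℝ, 0 < L ∧ ∃ η : ℝ, 0 < η ∧
      ∀ y, |y| ≤ η → |σ y - s| ≤ L * |y| := by
    have hd : HasDerivAt σ (deriv σ 0) 0 :=
      ((hσ.differentiable (by simp)) 0).hasDerivAt
    obtain ⟨L, hL, hLb⟩ := hd.isBigO_sub.exists_pos
    obtain ⟨e, he, hb⟩ := Metric.eventually_nhds_iff.mp hLb.bound
    refine ⟨L, hL, e/2, by positivity, fun y hy => ?_⟩
    have := hb (y := y) (by rw [dist_zero_right, Real.norm_eq_abs]; linarith)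
    simpa using this
  obtain ⟨D, hD, hDdef⟩ : ∃ D : ℝ, 0 < D ∧ D = L * k / s^2 := ⟨_, by positivity, rfl⟩
  -- key approximation
  obtain ⟨A, hA, hAdef⟩ : ∃ A : ℝ, 0 < A ∧ A = D / s := ⟨_, by positivity, rfl⟩
  obtain ⟨B, hB, hBdef⟩ : ∃ B : ℝ, 0 < B ∧ B = 3 * s * D := ⟨_, by positivity, rfl⟩
  obtain ⟨C, hC, hCdef⟩ : ∃ C : ℝ, 0 < C ∧
      C = (A * (A + 4) * s^2 + 4 * B) / (s^4 / 2) * (1 / (2 * (1 - ρ^2))) :=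
    ⟨_, by positivity, rfl⟩
  obtain ⟨δ, hδ, hδ1, hδ2, hδ3⟩ : ∃ δ : ℝ, 0 < δ ∧ δ ≤ 1 ∧ δ ≤ η * s^2 / k ∧ δ ≤ s / (6 * D) :=
    ⟨min 1 (min (η * s^2 / k) (s / (6 * D))), by positivity, min_le_left _ _,
      (min_le_right _ _).trans (min_le_left _ _), (min_le_right _ _).trans (min_le_right _ _)⟩
  have key : ∀ x : ℝ, |x| ≤ δ → ∀ f df : ℝ → ℝ, Measurable df →
      IntegrableOn (fun s => (df s)^2) (Icc (0:ℝ) 1) →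
      (∀ t ∈ Icc (0:ℝ) 1, f t = ∫ s in Icc (0:ℝ) t, df s) →
      Etil df ≤ (|x| / s)^2 →
      |(x - ρ * Gtil K σ f df)^2 / (2 * (1 - ρ^2) * Ftil K σ f)
        - (x - ρ * (s * ∫ t in Icc (0:ℝ) 1, df t))^2 / s^2 * (1 / (2 * (1 - ρ^2)))|
        ≤ C * |x|^3 := by
    intro x hx f df hm hi hf hE
    have hx0 := abs_nonneg x
    have hx1 : |x| ≤ 1 := hx.trans hδ1
    have hxx : |x|^2 ≤ |x| := by nlinarith
    obtain ⟨g1, g2, g3, g4⟩ := aux_df f df (|x|/s) (by positivity) hm hi hf hE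
    obtain ⟨k1, k2⟩ := aux_kernel K c r hr hKmeas hKint CK hKbdd hKmoc hKvolterra f _ g3 g4
    have hkx : k * (|x|/s)^2 = k / s^2 * |x|^2 := by field_simp
    have hclose : ∀ t ∈ Icc (0:ℝ) 1, |σ (Kop K f f t) - s| ≤ D * |x|^2 := by
      intro t ht
      have h1 := k1 t ht
      rw [← hkdef, hkx] at h1
      have h2 : k / s^2 * |x|^2 ≤ η := by
        have h3 : |x|^2 ≤ η * s^2 / k := hxx.trans (hx.trans hδ2)
        rw [le_div_iff₀ hk] at h3
        rw [div_mul_eq_mul_div, div_le_iff₀ (by positivity)]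
        linarith
      refine (hLη _ (h1.trans h2)).trans ((mul_le_mul_of_nonneg_left h1 hL.le).trans_eq ?_)
      rw [hDdef]; ring
    have hDx : D * |x| ≤ s / 6 := by
      have h3 := hx.trans hδ3
      rw [le_div_iff₀ (by positivity)] at h3
      linarith
    have hDxx : D * |x|^2 ≤ D * |x| := mul_le_mul_of_nonneg_left hxx hD.le
    obtain ⟨hF, hG⟩ := aux_FG K σ f df s (D * |x|^2) (|x|/s) hs (by positivity) (by linarith)
      hσ.continuous k2 g1 g2 hclose
    set g := ∫ t in Icc (0:ℝ) 1, df t with hg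
    have hgb : |g| ≤ |x| / s := (abs_integral_le_integral_abs).trans g2
    have hsg : s * |g| ≤ |x| := by
      rw [le_div_iff₀ hs] at hgb; linarith
    have hF1 : |Ftil K σ f - s^2| ≤ B * |x| := by
      refine hF.trans ?_
      rw [hBdef]
      nlinarith [mul_le_mul_of_nonneg_left hDxx hs.le]
    have hF2 : s^2/2 ≤ Ftil K σ f := by
      have h1 := (abs_le.mp hF1).1
      rw [hBdef] at h1
      nlinarith [mul_le_mul_of_nonneg_left hDx hs.le]
    have hu : |(x - ρ * Gtil K σ f df) - (x - ρ * (s * g))| ≤ A * |x|^2 := by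
      have e : (x - ρ * Gtil K σ f df) - (x - ρ * (s * g)) = -(ρ * (Gtil K σ f df - s * g)) := by
        ring
      rw [e, abs_neg, abs_mul]
      have h1 : |ρ| * |Gtil K σ f df - s * g| ≤ 1 * (D * |x|^2 * (|x|/s)) := by gcongr
      refine h1.trans ?_
      have e2 : 1 * (D * |x|^2 * (|x|/s)) = A * |x|^2 * |x| := by rw [hAdef]; ring
      rw [e2]
      exact mul_le_of_le_one_right (by positivity) hx1
    have hu0 : |x - ρ * (s * g)| ≤ 2 * |x| := by
      refine (abs_sub _ _).trans ?_
      rw [abs_mul, abs_mul, abs_of_pos hs]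
      have : |ρ| * (s * |g|) ≤ 1 * |x| := by gcongr
      linarith
    have h := aux_alg _ _ _ s A B x hs hA.le hx1 hu hu0 hF1 hF2
    have hFpos : 0 < Ftil K σ f := lt_of_lt_of_le (by positivity) hF2
    have e3 : (x - ρ * Gtil K σ f df)^2 / (2 * (1 - ρ^2) * Ftil K σ f)
        = (x - ρ * Gtil K σ f df)^2 / Ftil K σ f * (1 / (2 * (1 - ρ^2))) := by
      field_simp
    rw [e3, ← sub_mul, abs_mul, abs_of_pos (by positivity : 0 < 1 / (2 * (1 - ρ^2))), hCdef]
    calc _ ≤ ((A * (A + 4) * s^2 + 4 * B) / (s^4 / 2) * |x|^3) * (1 / (2 * (1 - ρ^2))) := by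
          gcongr
      _ = _ := by ring
  refine ⟨δ, hδ, C, hC, fun x hx => ?_⟩
  have hpos : ∀ f df : ℝ → ℝ,
      0 ≤ (x - ρ * Gtil K σ f df)^2 / (2 * (1 - ρ^2) * Ftil K σ f) := by
    intro f df
    have : 0 ≤ Ftil K σ f := integral_nonneg fun _ => sq_nonneg _
    positivity
  have hEpos : ∀ df : ℝ → ℝ, 0 ≤ Etil df := fun df => integral_nonneg fun _ => sq_nonneg _
  have hCx : 0 ≤ C * |x|^3 := by positivity
  rw [abs_le]
  constructor
  · rw [neg_le_sub_iff_le_add, ← sub_le_iff_le_add]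
    refine le_csInf ⟨_, fun t => ∫ s in Icc (0:ℝ) t, (0:ℝ), fun _ => 0, measurable_const, by simp,
      fun _ _ => rfl, rfl⟩ ?_
    rintro y ⟨f, df, hm, hi, hf, rfl⟩
    by_cases hE : Etil df ≤ (|x|/s)^2
    · have h1 := (abs_le.mp (key x hx f df hm hi hf hE)).1
      have h2 := aux_quad x (∫ t in Icc (0:ℝ) 1, df t) s ρ hs hρ2
      have h3 : (∫ t in Icc (0:ℝ) 1, df t)^2 ≤ Etil df := by
        have h4 := (aux_cs df hm.aestronglyMeasurable hi).2
        refine le_trans ?_ h4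
        rw [← sq_abs]
        have := abs_integral_le_integral_abs (f := df) (μ := volume.restrict (Icc (0:ℝ) 1))
        gcongr
      linarith
    · have h1 := hpos f df
      rw [div_pow, sq_abs] at hE
      have : x^2 / (2 * s^2) = 1/2 * (x^2 / s^2) := by field_simp
      linarith [not_le.mp hE]
  · set a := ρ * x / s with ha
    have hEa : Etil (fun _ => a) = a^2 := by simp [Etil]
    have hEa2 : Etil (fun _ => a) ≤ (|x|/s)^2 := by
      rw [hEa, ha, div_pow, div_pow, sq_abs]
      refine div_le_div_of_nonneg_right ?_ (by positivity)
      rw [mul_pow]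
      exact mul_le_of_le_one_left (sq_nonneg x) (sub_pos.mp hρ2).le
    have h1 := (abs_le.mp (key x hx (fun t => ∫ s in Icc (0:ℝ) t, a) (fun _ => a)
      measurable_const (integrable_const _) (fun _ _ => rfl) hEa2)).2
    have h2 : rateFun K σ ρ x ≤ _ := csInf_le
      ⟨0, by
        rintro y ⟨f, df, hm, hi, hf, rfl⟩
        have := hpos f df
        have := hEpos df
        positivity⟩
      ⟨fun t => ∫ s in Icc (0:ℝ) t, a, fun _ => a, measurable_const, integrable_const _,
        fun _ _ => rfl, rfl⟩
    have hint : (∫ t in Icc (0:ℝ) 1, a) = a := by simp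
    rw [hint] at h1
    rw [hEa] at h2
    have h3 : (x - ρ * (s * a))^2 / s^2 * (1 / (2 * (1 - ρ^2))) + 1/2 * a^2 = x^2 / (2 * s^2) := by
      rw [ha]; field_simp; ring
    linarith

/-- second-order Taylor expansion of the rate function:
`I(x) = x²/(2σ₀²) + O(x³)` as `x → 0`, with `σ₀ = σ(0)`; in particular
`I(0) = 0`, `I′(0) = 0` and `I″(0) = 1/σ₀²`. -/
theorem rate_function_taylor_expansion
    (K : ℝ → ℝ → ℝ) (c r : ℝ) (hc : 0 < c) (hr : 0 < r)
    (hKmeas : Measurable (Function.uncurry K))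
    (hKint : ∀ t ∈ Icc (0:ℝ) 1, IntegrableOn (fun s => (K t s)^2) (Icc (0:ℝ) 1))
    (CK : ℝ) (hKbdd : ∀ t ∈ Icc (0:ℝ) 1, (∫ s in Icc (0:ℝ) 1, (K t s)^2) ≤ CK)
    (hKmoc : ∀ t₁ ∈ Icc (0:ℝ) 1, ∀ t₂ ∈ Icc (0:ℝ) 1,
      (∫ s in Icc (0:ℝ) 1, (K t₁ s - K t₂ s)^2) ≤ c * |t₁ - t₂| ^ r)
    (hKvolterra : ∀ t s : ℝ, 0 ≤ t → t < s → s ≤ 1 → K t s = 0)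
    (σ : ℝ → ℝ) (hσ : ContDiff ℝ (⊤ : ℕ∞) σ) (hσpos : ∀ x, 0 < σ x)
    (ρ : ℝ) (hρ : ρ ∈ Ioo (-1:ℝ) 1)
    -- assumed local smoothness of the rate function near 0
    (hsmooth : ∃ u ∈ nhds (0:ℝ), ContDiffOn ℝ 3 (rateFun K σ ρ) u) :
    (∃ δ : ℝ, 0 < δ ∧ ∃ C : ℝ, 0 < C ∧ ∀ x : ℝ, |x| ≤ δ →
      |rateFun K σ ρ x - x^2 / (2 * (σ 0)^2)| ≤ C * |x|^3) ∧
    rateFun K σ ρ 0 = 0 ∧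
    deriv (rateFun K σ ρ) 0 = 0 ∧
    iteratedDeriv 2 (rateFun K σ ρ) 0 = 1 / (σ 0)^2 := by
  obtain ⟨δ, hδ, C, hC, h⟩ := rate_bound K c r hr hKmeas hKint CK hKbdd hKmoc hKvolterra σ hσ
    hσpos ρ hρ
  obtain ⟨h0, h1, h2⟩ := aux_taylor (rateFun K σ ρ) (1 / (2 * (σ 0)^2)) C δ hδ
    (fun x hx => by simpa [div_eq_mul_inv] using h x hx) hsmooth
  refine ⟨⟨δ, hδ, C, hC, h⟩, h0, h1, ?_⟩
  rw [h2]
  have := (hσpos 0).ne'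
  field_simp
end
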